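/- Let a, b, s be positive reals and set τ = a/(a+s). Define v_Q = a + τ²·b, v_Y = a + b + s, v_X = b, c₁ = a + τ·b, and c₂ = τ·b. Then v_Q·v_Y − c₁² > 0, v_Q·v_X − c₂² > 0, and (v_Q·v_Y)/(v_Q·v_Y − c₁²) · (v_Q·v_X − c₂²)/(v_Q·v_X) = 1 + a/s. Consequently, (1/2)·log₂( v_Q·v_Y/(v_Q·v_Y − c₁²) ) − (1/2)·log₂( v_Q·v_X/(v_Q·v_X − c₂²) ) = (1/2)·log₂(1 + a/s). -/

import Mathlib

/-- Algebraic identity underlying the dirty paper coding (Costa) rate: with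
`τ = a/(a+s)`, `v_Q = a + τ²b`, `v_Y = a + b + s`, `v_X = b`, `c₁ = a + τb`,
`c₂ = τb`, the quantities `v_Q v_Y - c₁²` and `v_Q v_X - c₂²` are positive,
`(v_Q v_Y)/(v_Q v_Y - c₁²) · (v_Q v_X - c₂²)/(v_Q v_X) = 1 + a/s`, and hence
`½ log₂(v_Q v_Y/(v_Q v_Y - c₁²)) - ½ log₂(v_Q v_X/(v_Q v_X - c₂²)) = ½ log₂(1 + a/s)`. -/
theorem stmt_11 (a b s : ℝ) (ha : 0 < a) (hb : 0 < b) (hs : 0 < s)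
    (τ vQ vY vX c1 c2 : ℝ)
    (hτ : τ = a / (a + s))
    (hvQ : vQ = a + τ ^ 2 * b) (hvY : vY = a + b + s) (hvX : vX = b)
    (hc1 : c1 = a + τ * b) (hc2 : c2 = τ * b) :
    0 < vQ * vY - c1 ^ 2 ∧ 0 < vQ * vX - c2 ^ 2 ∧
    (vQ * vY) / (vQ * vY - c1 ^ 2) * ((vQ * vX - c2 ^ 2) / (vQ * vX)) = 1 + a / s ∧
    (1 / 2) * Real.logb 2 ((vQ * vY) / (vQ * vY - c1 ^ 2))
        - (1 / 2) * Real.logb 2 ((vQ * vX) / (vQ * vX - c2 ^ 2))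
      = (1 / 2) * Real.logb 2 (1 + a / s) := by
  have has : 0 < a + s := by positivity
  have hY : 0 < vY := by rw [hvY]; positivity
  have hX : 0 < vX := by rw [hvX]; exact hb
  have hQ : 0 < vQ := by rw [hvQ]; positivity
  have e1 : vQ * vY - c1 ^ 2 = a * s * vY / (a + s) := by
    rw [hvQ, hc1, hvY, hτ]
    field_simp
    ring
  have e2 : vQ * vX - c2 ^ 2 = a * vX := by
    rw [hvQ, hc2, hvX]
    ring
  have h1 : 0 < vQ * vY - c1 ^ 2 := by rw [e1]; positivity
  have h2 : 0 < vQ * vX - c2 ^ 2 := by rw [e2]; positivity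
  have h3 : (vQ * vY) / (vQ * vY - c1 ^ 2) * ((vQ * vX - c2 ^ 2) / (vQ * vX))
      = 1 + a / s := by
    rw [e1, e2]
    field_simp
    ring
  refine ⟨h1, h2, h3, ?_⟩
  rw [← mul_sub, ← Real.logb_div (by positivity) (by positivity), ← h3, div_eq_mul_inv _
    (vQ * vX / (vQ * vX - c2 ^ 2)), inv_div]
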